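/- arXiv:2203.06329 — 4 statements merged into one kernel-verified Lean document; each statement's English description precedes it below -/
import Mathlib

section
/- Let K₀(x) := ∫_0^∞ exp(−x·cosh t) dt for x > 0. Then lim_{x→∞} √x·eˣ·K₀(x) = √(π/2). -/
open Real MeasureTheory Set Filter

/-- Integral representation of the modified Bessel function `K₀`. -/
noncomputable def K0 (x : ℝ) : ℝ := ∫ t in Ioi (0:ℝ), Real.exp (-x * Real.cosh t)

lemma cosh_eq_one_add_two_mul_sinh_half_sq (t : ℝ) :
    Real.cosh t = 1 + 2 * Real.sinh (t / 2) ^ 2 := by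
  have h := Real.cosh_two_mul (t / 2)
  rw [mul_div_cancel₀ t two_ne_zero, Real.cosh_sq] at h
  linarith

/-- The substitution `t = u / √x` in the integral defining `K₀`. -/
lemma sqrt_mul_exp_mul_K0_eq_integral {x : ℝ} (hx : 0 < x) :
    √x * Real.exp x * K0 x =
      ∫ u in Ioi (0:ℝ), Real.exp (-2 * (√x * Real.sinh ((√x)⁻¹ * (u / 2))) ^ 2) := by
  have hs : 0 < √x := Real.sqrt_pos.2 hx
  have h := integral_comp_mul_left_Ioi (fun t => Real.exp (-x * Real.cosh t)) 0 (inv_pos.2 hs)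
  rw [mul_zero, inv_inv, smul_eq_mul] at h
  rw [K0, mul_right_comm, ← h, ← integral_mul_const]
  refine setIntegral_congr_fun measurableSet_Ioi fun u _ => ?_
  simp only [← Real.exp_add]
  rw [cosh_eq_one_add_two_mul_sinh_half_sq, mul_pow, Real.sq_sqrt hx.le, mul_div_assoc]
  ring_nf

lemma tendsto_mul_sinh_inv_mul_atTop (a : ℝ) :
    Tendsto (fun y : ℝ => y * Real.sinh (y⁻¹ * a)) atTop (nhds a) := by
  have hd : HasDerivAt (fun h : ℝ => Real.sinh (h * a)) a 0 := by
    simpa using ((hasDerivAt_id (0:ℝ)).mul_const a).sinh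
  have h := hd.tendsto_slope_zero_right.comp tendsto_inv_atTop_nhdsGT_zero
  simpa [Function.comp_def] using h

lemma le_mul_sinh_inv_mul {y a : ℝ} (hy : 0 < y) (ha : 0 ≤ a) :
    a ≤ y * Real.sinh (y⁻¹ * a) := by
  calc a = y * (y⁻¹ * a) := by field_simp
    _ ≤ y * Real.sinh (y⁻¹ * a) := by
      gcongr
      exact Real.self_le_sinh_iff.2 (by positivity)

/-- `lim_{x→∞} √x · eˣ · K₀(x) = √(π/2)`. -/
theorem sqrt_mul_exp_mul_K0_tendsto_atTop :
    Tendsto (fun x : ℝ => Real.sqrt x * Real.exp x * K0 x) atTop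
      (nhds (Real.sqrt (π / 2))) := by
  have hlim : √(π / 2) = ∫ u in Ioi (0:ℝ), Real.exp (-2 * (u / 2) ^ 2) := by
    have h (u : ℝ) : -2 * (u / 2) ^ 2 = -(1 / 2) * u ^ 2 := by ring
    simp_rw [h]
    rw [integral_gaussian_Ioi, show π / (1 / 2) = 2 ^ 2 * (π / 2) by ring,
      Real.sqrt_mul (by positivity), Real.sqrt_sq (by norm_num)]
    ring
  rw [hlim]
  refine Tendsto.congr' ((eventually_gt_atTop 0).mono fun x hx =>
    (sqrt_mul_exp_mul_K0_eq_integral hx).symm) ?_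
  refine tendsto_integral_filter_of_dominated_convergence
    (fun u => Real.exp (-2 * (u / 2) ^ 2)) ?_ ?_ ?_ ?_
  · exact Eventually.of_forall fun x => Continuous.aestronglyMeasurable (by fun_prop)
  · filter_upwards [eventually_gt_atTop 0] with x hx
    filter_upwards [ae_restrict_mem measurableSet_Ioi] with u hu
    have hu' : 0 ≤ u / 2 := (half_pos hu).le
    have := pow_le_pow_left₀ hu' (le_mul_sinh_inv_mul (Real.sqrt_pos.2 hx) hu') 2
    rw [Real.norm_of_nonneg (Real.exp_pos _).le, Real.exp_le_exp]
    linarith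
  · refine ((integrable_exp_neg_mul_sq (b := 1 / 2) (by norm_num)).congr ?_).restrict
    exact Eventually.of_forall fun u => by ring_nf
  · refine Eventually.of_forall fun u => ?_
    exact (Real.continuous_exp.tendsto _).comp
      ((((tendsto_mul_sinh_inv_mul_atTop (u / 2)).comp Real.tendsto_sqrt_atTop).pow 2).const_mul _)
end

section
/- Let K₀(x) := ∫_0^∞ exp(−x·cosh t) dt for x > 0. Then lim_{x→0⁺} K₀(x)/(−log x) = 1. -/
open Real MeasureTheory Set Filter

theorem exp_neg_mul_cosh_le {x : ℝ} (hx : 0 < x) (t : ℝ) :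
    Real.exp (-x * Real.cosh t) ≤ Real.exp (-Real.log x / 2) * Real.exp (-(1 / 2) * t) := by
  rw [← Real.exp_add, Real.exp_le_exp]
  have h1 : t + Real.log x + 1 ≤ Real.exp t * x := by
    simpa [Real.exp_add, Real.exp_log hx] using Real.add_one_le_exp (t + Real.log x)
  have h2 : x * (Real.exp t / 2) ≤ x * Real.cosh t := by
    rw [Real.cosh_eq]
    gcongr
    linarith [Real.exp_pos (-t)]
  linarith

theorem integrableOn_exp_neg_mul_cosh {x : ℝ} (hx : 0 < x) (a : ℝ) :
    IntegrableOn (fun t => Real.exp (-x * Real.cosh t)) (Ioi a) := by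
  refine Integrable.mono'
    ((exp_neg_integrableOn_Ioi a (by norm_num : (0 : ℝ) < 1 / 2)).const_mul
      (Real.exp (-Real.log x / 2))) ?_ (ae_of_all _ fun t => ?_)
  · exact (by fun_prop : Continuous fun t => Real.exp (-x * Real.cosh t)).aestronglyMeasurable
  · rw [Real.norm_of_nonneg (Real.exp_pos _).le]
    exact exp_neg_mul_cosh_le hx t

theorem K0_eq_add {x : ℝ} (hx : 0 < x) {a : ℝ} (ha : 0 ≤ a) :
    K0 x = (∫ t in (0 : ℝ)..a, Real.exp (-x * Real.cosh t)) +
      ∫ t in Ioi a, Real.exp (-x * Real.cosh t) := by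
  rw [K0, intervalIntegral.integral_of_le ha, ← Ioc_union_Ioi_eq_Ioi ha,
    setIntegral_union (Ioc_disjoint_Ioi le_rfl) measurableSet_Ioi
      ((integrableOn_exp_neg_mul_cosh hx 0).mono_set Ioc_subset_Ioi_self)
      (integrableOn_exp_neg_mul_cosh hx a)]

theorem K0_le_neg_log_add_two {x : ℝ} (hx : 0 < x) (hx1 : x ≤ 1) :
    K0 x ≤ -Real.log x + 2 := by
  have hL : 0 ≤ -Real.log x := by linarith [Real.log_nonpos hx.le hx1]
  rw [K0_eq_add hx hL]
  refine add_le_add ?_ ?_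
  · calc (∫ t in (0 : ℝ)..-Real.log x, Real.exp (-x * Real.cosh t))
        ≤ ∫ _ in (0 : ℝ)..-Real.log x, (1 : ℝ) := by
          refine intervalIntegral.integral_mono_on hL
            (Continuous.intervalIntegrable (by fun_prop) _ _) (by simp) fun t _ => ?_
          rw [Real.exp_le_one_iff]
          nlinarith [Real.cosh_pos t]
      _ = -Real.log x := by simp
  · calc (∫ t in Ioi (-Real.log x), Real.exp (-x * Real.cosh t))
        ≤ ∫ t in Ioi (-Real.log x), Real.exp (-Real.log x / 2) * Real.exp (-(1 / 2) * t) :=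
          setIntegral_mono (integrableOn_exp_neg_mul_cosh hx _)
            ((exp_neg_integrableOn_Ioi _ (by norm_num : (0 : ℝ) < 1 / 2)).const_mul _)
            (exp_neg_mul_cosh_le hx)
      _ = 2 * Real.exp (-Real.log x / 2 + -(1 / 2) * -Real.log x) := by
          rw [integral_const_mul, integral_exp_mul_Ioi (by norm_num), Real.exp_add]
          ring
      _ = 2 := by
          rw [show -Real.log x / 2 + -(1 / 2) * -Real.log x = 0 by ring, Real.exp_zero, mul_one]

theorem neg_log_sub_one_le_K0 {x : ℝ} (hx : 0 < x) (hx1 : x ≤ 1) :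
    -Real.log x - 1 ≤ K0 x := by
  have hL : 0 ≤ -Real.log x := by linarith [Real.log_nonpos hx.le hx1]
  have htail : 0 ≤ ∫ t in Ioi (-Real.log x), Real.exp (-x * Real.cosh t) :=
    integral_nonneg fun t => (Real.exp_pos _).le
  have hhead : (∫ t in (0 : ℝ)..-Real.log x, (1 - x * Real.exp t)) ≤
      ∫ t in (0 : ℝ)..-Real.log x, Real.exp (-x * Real.cosh t) := by
    refine intervalIntegral.integral_mono_on hL (Continuous.intervalIntegrable (by fun_prop) _ _)
      (Continuous.intervalIntegrable (by fun_prop) _ _) fun t ht => ?_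
    have h1 : x * Real.cosh t ≤ x * Real.exp t := by
      gcongr
      rw [Real.cosh_eq]
      linarith [Real.exp_le_exp.2 (by linarith [ht.1] : -t ≤ t)]
    linarith [Real.add_one_le_exp (-x * Real.cosh t)]
  have hval : (∫ t in (0 : ℝ)..-Real.log x, (1 - x * Real.exp t)) = -Real.log x - 1 + x := by
    rw [intervalIntegral.integral_sub (by simp)
      (Continuous.intervalIntegrable (by fun_prop) _ _), intervalIntegral.integral_const_mul,
      integral_exp, Real.exp_neg, Real.exp_log hx]
    simp
    field_simp
    ring
  rw [K0_eq_add hx hL]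
  linarith

/-- `lim_{x→0⁺} K₀(x)/(−log x) = 1`. -/
theorem K0_div_neg_log_tendsto_zero :
    Tendsto (fun x : ℝ => K0 x / (-Real.log x)) (nhdsWithin 0 (Ioi 0)) (nhds 1) := by
  have hlog : Tendsto (fun x : ℝ => -Real.log x) (nhdsWithin 0 (Ioi 0)) atTop :=
    tendsto_neg_atBot_atTop.comp Real.tendsto_log_nhdsGT_zero
  have hlower : Tendsto (fun x : ℝ => 1 - 1 / (-Real.log x)) (nhdsWithin 0 (Ioi 0)) (nhds 1) := by
    simpa only [sub_zero] using (hlog.const_div_atTop 1).const_sub 1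
  have hupper : Tendsto (fun x : ℝ => 1 + 2 / (-Real.log x)) (nhdsWithin 0 (Ioi 0)) (nhds 1) := by
    simpa only [add_zero] using (hlog.const_div_atTop 2).const_add 1
  have hmem : ∀ᶠ x : ℝ in nhdsWithin 0 (Ioi 0), x ∈ Ioo (0 : ℝ) 1 :=
    Ioo_mem_nhdsGT one_pos
  refine tendsto_of_tendsto_of_tendsto_of_le_of_le' hlower hupper ?_ ?_
  · filter_upwards [hmem] with x hx
    have hL : 0 < -Real.log x := neg_pos.2 (Real.log_neg hx.1 hx.2)
    rw [le_div_iff₀ hL, sub_mul, div_mul_cancel₀ _ hL.ne', one_mul]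
    exact neg_log_sub_one_le_K0 hx.1 hx.2.le
  · filter_upwards [hmem] with x hx
    have hL : 0 < -Real.log x := neg_pos.2 (Real.log_neg hx.1 hx.2)
    rw [div_le_iff₀ hL, add_mul, div_mul_cancel₀ _ hL.ne', one_mul]
    exact K0_le_neg_log_add_two hx.1 hx.2.le
end

section
/- There exists a constant c > 0 such that for all ν ≥ 2 and all 0 < z ≤ 1, M²(ν,z) ≥ c·z⁻¹·e^ν. -/
open Real MeasureTheory Set Filter

/-- Bessel modulus squared, via Nicholson's formula. -/
noncomputable def M2 (ν z : ℝ) : ℝ :=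
  (8 / π ^ 2) * ∫ t in Ioi (0:ℝ), K0 (2 * z * Real.sinh t) * Real.cosh (2 * ν * t)

lemma K0_integrand_integrableOn {x : ℝ} (hx : 0 < x) :
    IntegrableOn (fun t => Real.exp (-x * Real.cosh t)) (Ioi (0:ℝ)) := by
  refine Integrable.mono' (exp_neg_integrableOn_Ioi 0 hx)
    (by fun_prop : Continuous _).aestronglyMeasurable ?_
  filter_upwards [ae_restrict_mem measurableSet_Ioi] with t ht
  rw [Real.norm_eq_abs, abs_of_pos (Real.exp_pos _), Real.exp_le_exp]
  have h1 : t ≤ Real.sinh t := Real.self_le_sinh_iff.2 (le_of_lt ht)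
  nlinarith [Real.sinh_lt_cosh t]

lemma K0_nonneg (x : ℝ) : 0 ≤ K0 x :=
  integral_nonneg fun _ => (Real.exp_pos _).le

lemma exp_neg_mul_cosh_one_le_K0 {x : ℝ} (hx : 0 < x) :
    Real.exp (-x * Real.cosh 1) ≤ K0 x := by
  have hi := K0_integrand_integrableOn hx
  have hsub : Ioc (0:ℝ) 1 ⊆ Ioi 0 := fun t ht => ht.1
  calc Real.exp (-x * Real.cosh 1)
      = ∫ _ in Ioc (0:ℝ) 1, Real.exp (-x * Real.cosh 1) := by simp
    _ ≤ ∫ t in Ioc (0:ℝ) 1, Real.exp (-x * Real.cosh t) := by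
        refine setIntegral_mono_on (by simp) (hi.mono_set hsub) measurableSet_Ioc ?_
        intro t ht
        have : Real.cosh t ≤ Real.cosh 1 := by
          rw [Real.cosh_le_cosh, abs_of_pos ht.1, abs_one]
          exact ht.2
        rw [Real.exp_le_exp]
        nlinarith
    _ ≤ K0 x := setIntegral_mono_set hi
        (Eventually.of_forall fun _ => (Real.exp_pos _).le) hsub.eventuallyLE

lemma one_add_sq_half_le_cosh (t : ℝ) : 1 + t ^ 2 / 2 ≤ Real.cosh t := by
  have h1 : |t| / 2 ≤ Real.sinh (|t| / 2) := Real.self_le_sinh_iff.2 (by positivity)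
  have h2 : Real.cosh t = 1 + 2 * Real.sinh (|t| / 2) ^ 2 := by
    have h := Real.cosh_two_mul (|t| / 2)
    rw [mul_div_cancel₀ _ two_ne_zero, Real.cosh_abs] at h
    rw [h, Real.cosh_sq]
    ring
  have h3 : 0 ≤ |t| := abs_nonneg t
  have h4 := sq_abs t
  nlinarith

lemma K0_le {x : ℝ} (hx : 0 < x) :
    K0 x ≤ Real.exp (-x) * (√(π / (x / 2)) / 2) := by
  rw [← integral_gaussian_Ioi, ← integral_const_mul]
  refine setIntegral_mono_on (K0_integrand_integrableOn hx)
    ((integrable_exp_neg_mul_sq (half_pos hx)).integrableOn.const_mul _) measurableSet_Ioi ?_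
  intro t _
  rw [← Real.exp_add, Real.exp_le_exp]
  nlinarith [one_add_sq_half_le_cosh t]

lemma stronglyMeasurable_K0 : StronglyMeasurable K0 := by
  have : StronglyMeasurable (Function.uncurry fun x t : ℝ => Real.exp (-x * Real.cosh t)) := by
    refine Continuous.stronglyMeasurable ?_
    simp only [Function.uncurry_def]
    fun_prop
  exact this.integral_prod_right

lemma sq_div_four_le_sinh {t : ℝ} (ht : 0 ≤ t) : t ^ 2 / 4 ≤ Real.sinh t := by
  have h1 := Real.quadratic_le_exp_of_nonneg ht
  have h2 : Real.exp (-t) ≤ 1 := Real.exp_le_one_iff.2 (by linarith)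
  rw [Real.sinh_eq]
  linarith

lemma M2_integrand_integrableOn {ν z : ℝ} (hν : 0 ≤ ν) (hz : 0 < z) :
    IntegrableOn (fun t => K0 (2 * z * Real.sinh t) * Real.cosh (2 * ν * t)) (Ioi (0:ℝ)) := by
  have hG := (Real.GammaIntegral_convergent (s := 1 / 2) (by norm_num)).const_mul
    (√(π / z) * Real.exp ((2 * ν + 1) ^ 2 / (2 * z)))
  refine Integrable.mono' hG ?_ ?_
  · exact ((stronglyMeasurable_K0.comp_measurable
      (by fun_prop : Continuous fun t : ℝ => 2 * z * Real.sinh t).measurable).mul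
      (by fun_prop : Continuous fun t : ℝ =>
        Real.cosh (2 * ν * t)).stronglyMeasurable).aestronglyMeasurable
  filter_upwards [ae_restrict_mem measurableSet_Ioi] with t (ht : 0 < t)
  have hs : t ≤ Real.sinh t := Real.self_le_sinh_iff.2 ht.le
  have hs0 : 0 < Real.sinh t := ht.trans_le hs
  have hx : 0 < 2 * z * Real.sinh t := by positivity
  rw [Real.norm_eq_abs, abs_of_nonneg (mul_nonneg (K0_nonneg _) (Real.cosh_pos _).le)]
  have hcosh : Real.cosh (2 * ν * t) ≤ Real.exp (2 * ν * t) := by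
    have : 0 ≤ Real.sinh (2 * ν * t) := Real.sinh_nonneg_iff.2 (by positivity)
    linarith [Real.cosh_add_sinh (2 * ν * t)]
  have hsqrt : √(π / (2 * z * Real.sinh t / 2)) / 2 ≤ √(π / z) * t ^ ((1:ℝ) / 2 - 1) := by
    have hpow : t ^ ((1:ℝ) / 2 - 1) = √(1 / t) := by
      rw [Real.sqrt_eq_rpow, one_div t, Real.inv_rpow ht.le, ← Real.rpow_neg ht.le]
      norm_num
    rw [hpow, ← Real.sqrt_mul (by positivity)]
    have : √(π / (2 * z * Real.sinh t / 2)) ≤ √(π / z * (1 / t)) := by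
      apply Real.sqrt_le_sqrt
      rw [div_mul_div_comm, mul_one]
      gcongr
      nlinarith
    linarith [Real.sqrt_nonneg (π / (2 * z * Real.sinh t / 2))]
  have hexp : Real.exp (-(2 * z * Real.sinh t)) * Real.exp (2 * ν * t)
      ≤ Real.exp ((2 * ν + 1) ^ 2 / (2 * z)) * Real.exp (-t) := by
    rw [← Real.exp_add, ← Real.exp_add, Real.exp_le_exp]
    have h1 := mul_le_mul_of_nonneg_left (sq_div_four_le_sinh ht.le) (by positivity : 0 ≤ 2 * z)
    have h2 : (2 * ν + 1) ^ 2 / (2 * z) - (2 * ν + 1) * t + z * t ^ 2 / 2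
        = (2 * ν + 1 - z * t) ^ 2 / (2 * z) := by
      field_simp
      ring
    have h3 : 0 ≤ (2 * ν + 1 - z * t) ^ 2 / (2 * z) := by positivity
    linarith
  calc K0 (2 * z * Real.sinh t) * Real.cosh (2 * ν * t)
      ≤ (Real.exp (-(2 * z * Real.sinh t)) * (√(π / (2 * z * Real.sinh t / 2)) / 2))
          * Real.exp (2 * ν * t) :=
        mul_le_mul (K0_le hx) hcosh (Real.cosh_pos _).le (by positivity)
    _ = (√(π / (2 * z * Real.sinh t / 2)) / 2)
          * (Real.exp (-(2 * z * Real.sinh t)) * Real.exp (2 * ν * t)) := by ring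
    _ ≤ (√(π / z) * t ^ ((1:ℝ) / 2 - 1))
          * (Real.exp ((2 * ν + 1) ^ 2 / (2 * z)) * Real.exp (-t)) := by gcongr
    _ = _ := by ring

/-- There is `c > 0` with `M²(ν,z) ≥ c·z⁻¹·e^ν` for all `ν ≥ 2` and `0 < z ≤ 1`. -/
theorem M2_lower_bound :
    ∃ c : ℝ, 0 < c ∧ ∀ ν z : ℝ, 2 ≤ ν → 0 < z → z ≤ 1 →
      c * z⁻¹ * Real.exp ν ≤ M2 ν z := by
  refine ⟨8 / π ^ 2 * (Real.exp (-Real.exp 2 * Real.cosh 1) / 2), by positivity, ?_⟩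
  intro ν z hν hz hz1
  have hi := M2_integrand_integrableOn (by linarith : 0 ≤ ν) hz
  have hlog : Real.log z ≤ 0 := Real.log_nonpos hz.le hz1
  set a := 1 - Real.log z with ha
  have hsub : Ioc a (a + 1) ⊆ Ioi 0 := fun t ht => by
    have := ht.1
    simp only [mem_Ioi]
    linarith
  have hpoint : ∀ t ∈ Ioc a (a + 1),
      Real.exp (-Real.exp 2 * Real.cosh 1) * (z⁻¹ * Real.exp ν / 2)
        ≤ K0 (2 * z * Real.sinh t) * Real.cosh (2 * ν * t) := by
    intro t ht
    have ht0 : 0 < t := hsub ht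
    have hs0 : 0 < Real.sinh t := Real.sinh_pos_iff.2 ht0
    have hx : 2 * z * Real.sinh t ≤ Real.exp 2 := by
      have h1 : 2 * Real.sinh t ≤ Real.exp t := by
        rw [Real.sinh_eq]
        linarith [Real.exp_pos (-t)]
      calc 2 * z * Real.sinh t = z * (2 * Real.sinh t) := by ring
        _ ≤ Real.exp (Real.log z) * Real.exp t := by rw [Real.exp_log hz]; gcongr
        _ ≤ Real.exp 2 := by
          rw [← Real.exp_add, Real.exp_le_exp]
          linarith [ht.2]
    have hK : Real.exp (-Real.exp 2 * Real.cosh 1) ≤ K0 (2 * z * Real.sinh t) := by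
      refine le_trans ?_ (exp_neg_mul_cosh_one_le_K0 (by positivity))
      rw [Real.exp_le_exp]
      nlinarith [Real.cosh_pos 1]
    have hC : z⁻¹ * Real.exp ν / 2 ≤ Real.cosh (2 * ν * t) := by
      have h1 : z⁻¹ * Real.exp ν ≤ Real.exp (2 * ν * t) := by
        rw [← Real.exp_log (inv_pos.2 hz), ← Real.exp_add, Real.exp_le_exp, Real.log_inv]
        nlinarith [ht.1]
      rw [Real.cosh_eq]
      linarith [Real.exp_pos (-(2 * ν * t))]
    exact mul_le_mul hK hC (by positivity) (K0_nonneg _)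
  calc 8 / π ^ 2 * (Real.exp (-Real.exp 2 * Real.cosh 1) / 2) * z⁻¹ * Real.exp ν
      = 8 / π ^ 2 * ∫ _ in Ioc a (a + 1),
          Real.exp (-Real.exp 2 * Real.cosh 1) * (z⁻¹ * Real.exp ν / 2) := by
        simp
        ring
    _ ≤ 8 / π ^ 2 * ∫ t in Ioc a (a + 1),
          K0 (2 * z * Real.sinh t) * Real.cosh (2 * ν * t) := by
        refine mul_le_mul_of_nonneg_left ?_ (by positivity)
        exact setIntegral_mono_on (integrableOn_const (by simp)) (hi.mono_set hsub)
          measurableSet_Ioc hpoint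
    _ ≤ M2 ν z := by
        refine mul_le_mul_of_nonneg_left ?_ (by positivity)
        exact setIntegral_mono_set hi
          (Eventually.of_forall fun _ => mul_nonneg (K0_nonneg _) (Real.cosh_pos _).le)
          hsub.eventuallyLE
end

section
/- For each nonnegative integer k there is a constant C_k > 0 such that for all real x ≥ 2, the k-th derivative of the Gamma function satisfies |Γ^(k)(x)| ≤ C_k·x^k·Γ(x). -/
open Real Filter

/-- On the right half-plane, the modulus of `Γ` is bounded by its value at the real part. -/
theorem Complex.norm_Gamma_le_Gamma_re {s : ℂ} (hs : 0 < s.re) :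
    ‖Complex.Gamma s‖ ≤ Real.Gamma s.re := by
  rw [Complex.Gamma_eq_integral hs, Real.Gamma_eq_integral hs, Complex.GammaIntegral]
  refine (MeasureTheory.norm_integral_le_integral_norm _).trans_eq ?_
  refine MeasureTheory.setIntegral_congr_fun measurableSet_Ioi fun t ht => ?_
  simp [Complex.norm_cpow_eq_rpow_re_of_pos ht, -Complex.ofReal_exp, -Complex.ofReal_neg,
    abs_of_pos (Real.exp_pos _)]

theorem Complex.differentiableOn_Gamma_re_pos :
    DifferentiableOn ℂ Complex.Gamma {s | 0 < s.re} := fun s hs =>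
  (Complex.differentiableAt_Gamma s fun m h => by
    have : (0 : ℝ) < -m := by simpa [h] using hs
    linarith [m.cast_nonneg (α := ℝ)]).differentiableWithinAt

/-- On the positive half-line, the iterated derivatives of the real Gamma function are the real
parts of those of the complex Gamma function. -/
theorem Real.iteratedDeriv_Gamma_eq_re (k : ℕ) {x : ℝ} (hx : 0 < x) :
    iteratedDeriv k Real.Gamma x = (iteratedDeriv k Complex.Gamma x).re := by
  induction k generalizing x with
  | zero => simp [Complex.Gamma_ofReal]
  | succ k ih =>
    have han : AnalyticAt ℂ Complex.Gamma x :=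
      Complex.differentiableOn_Gamma_re_pos.analyticAt
        ((isOpen_lt continuous_const Complex.continuous_re).mem_nhds (by simpa using hx))
    have hd : HasDerivAt (iteratedDeriv k Complex.Gamma) (iteratedDeriv (k + 1) Complex.Gamma x)
        x := by
      rw [iteratedDeriv_succ, iteratedDeriv_eq_iterate]
      exact (han.iterated_deriv k).differentiableAt.hasDerivAt
    rw [iteratedDeriv_succ]
    refine (hd.real_of_complex.congr_of_eventuallyEq ?_).deriv
    filter_upwards [lt_mem_nhds hx] with y hy using ih hy

/-- On the unit circle around `x ≥ 2`, the complex Gamma function is bounded by `x * Γ x`. -/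
theorem Complex.norm_Gamma_le_of_mem_sphere {x : ℝ} (hx : 2 ≤ x) {z : ℂ}
    (hz : z ∈ Metric.sphere (x : ℂ) 1) : ‖Complex.Gamma z‖ ≤ x * Real.Gamma x := by
  have hre : |z.re - x| ≤ 1 := by
    rw [mem_sphere_iff_norm] at hz
    simpa [hz] using Complex.abs_re_le_norm (z - x)
  obtain ⟨h₁, h₂⟩ := abs_le.1 hre
  have hpos : 0 < Real.Gamma x := Real.Gamma_pos_of_pos (by linarith)
  have hleft : Real.Gamma (x - 1) ≤ x * Real.Gamma x := by
    have hrec := Real.Gamma_add_one (s := x - 1) (by linarith)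
    rw [sub_add_cancel] at hrec
    have := Real.Gamma_pos_of_pos (s := x - 1) (by linarith)
    nlinarith
  refine (Complex.norm_Gamma_le_Gamma_re (by linarith)).trans ?_
  refine (Real.convexOn_Gamma.le_max_of_mem_Icc (x := x - 1) (y := x + 1) (Set.mem_Ioi.2 ?_)
    (Set.mem_Ioi.2 ?_) ⟨?_, ?_⟩).trans (max_le hleft (Real.Gamma_add_one ?_).le) <;> linarith

/-- For each `k` there is `C_k > 0` such that `|Γ^(k)(x)| ≤ C_k·x^k·Γ(x)` for all `x ≥ 2`. -/
theorem gamma_iteratedDeriv_bound (k : ℕ) :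
    ∃ C : ℝ, 0 < C ∧ ∀ x : ℝ, 2 ≤ x →
      |iteratedDeriv k Real.Gamma x| ≤ C * x ^ k * Real.Gamma x := by
  refine ⟨k.factorial, by positivity, fun x hx => ?_⟩
  have hpos : 0 < Real.Gamma x := Real.Gamma_pos_of_pos (by linarith)
  rcases eq_or_ne k 0 with rfl | hk
  · simp [abs_of_pos hpos]
  have hdiff : DiffContOnCl ℂ Complex.Gamma (Metric.ball (x : ℂ) 1) := by
    refine (Complex.differentiableOn_Gamma_re_pos.mono fun z hz => ?_).diffContOnCl
    have h := Metric.closure_ball_subset_closedBall hz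
    rw [mem_closedBall_iff_norm] at h
    have h' := (abs_le.1 ((Complex.abs_re_le_norm (z - x)).trans h)).1
    simp only [Complex.sub_re, Complex.ofReal_re] at h'
    exact show 0 < z.re by linarith
  rw [Real.iteratedDeriv_Gamma_eq_re k (by linarith)]
  calc |(iteratedDeriv k Complex.Gamma x).re|
      ≤ ‖iteratedDeriv k Complex.Gamma x‖ := Complex.abs_re_le_norm _
    _ ≤ k.factorial * (x * Real.Gamma x) / 1 ^ k :=
        Complex.norm_iteratedDeriv_le_of_forall_mem_sphere_norm_le k one_pos hdiff
          fun z hz => Complex.norm_Gamma_le_of_mem_sphere hx hz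
    _ = k.factorial * x * Real.Gamma x := by rw [one_pow, div_one, mul_assoc]
    _ ≤ k.factorial * x ^ k * Real.Gamma x := by
        gcongr
        exact le_self_pow₀ (by linarith) hk
end
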